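/- Let P be a polynomial with complex coefficients of degree n, let Q(z) = z^n · conj(P(1/conj(z))) be its conjugate-reciprocal polynomial, let a be a complex number with |a| ≤ 1, and let α, β be complex numbers with |α| ≤ 1 and |β| ≤ 1. Then for every real R ≥ 1 and every complex z with |z| ≥ 1, |S̃_a[P](Rz) − α·S̃_a[P](z) + β(((R+1)/2)^n − |α|)·S̃_a[P](z)| + |S̃_a[Q](Rz) − α·S̃_a[Q](z) + β(((R+1)/2)^n − |α|)·S̃_a[Q](z)| ≤ [ |R^n − α + β(((R+1)/2)^n − |α|)| · n|z|^(n−1) + |1 − α + β(((R+1)/2)^n − |α|)| · n|a| ] · max_{|w|=1} |P(w)|. -/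

import Mathlib

open Polynomial

/-- The modified Smirnov operator: S̃ₐ[P](z) = (1+az)·P′(z) − n·a·P(z). -/
noncomputable def smirnov (n : ℕ) (a : ℂ) (P : Polynomial ℂ) (z : ℂ) : ℂ :=
  (1 + a * z) * P.derivative.eval z - (n : ℂ) * a * P.eval z

/-- The maximum of ‖P‖ on the unit circle. -/
noncomputable def maxCircle (P : Polynomial ℂ) : ℝ :=
  sSup {y : ℝ | ∃ w : ℂ, ‖w‖ = 1 ∧ y = ‖P.eval w‖}

/-- The polynomial whose values are given by `smirnov`. -/
noncomputable def smirnovPoly (n : ℕ) (a : ℂ) (P : ℂ[X]) : ℂ[X] :=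
  derivative P + C a * (X * derivative P) - C (n * a) * P

theorem eval_smirnovPoly (n : ℕ) (a : ℂ) (P : ℂ[X]) (z : ℂ) :
    (smirnovPoly n a P).eval z = smirnov n a P z := by
  simp [smirnovPoly, smirnov]
  ring

theorem smirnov_sub (n : ℕ) (a : ℂ) (P Q : ℂ[X]) (z : ℂ) :
    smirnov n a (P - Q) z = smirnov n a P z - smirnov n a Q z := by
  simp [smirnov]
  ring

theorem smirnov_C_mul (n : ℕ) (a c : ℂ) (P : ℂ[X]) (z : ℂ) :
    smirnov n a (C c * P) z = c * smirnov n a P z := by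
  simp [smirnov]
  ring

theorem smirnov_one (n : ℕ) (a z : ℂ) : smirnov n a 1 z = -(n * a) := by
  simp [smirnov]

theorem smirnov_X_pow {n : ℕ} (hn : n ≠ 0) (a z : ℂ) :
    smirnov n a (X ^ n) z = n * z ^ (n - 1) := by
  obtain ⟨k, rfl⟩ := Nat.exists_eq_succ_of_ne_zero hn
  simp [smirnov]
  ring

/-- The relation `‖z * s - k‖ < ‖s‖` says that `s / k = 1 / (z - ζ)` with `‖ζ‖ < 1`; such `s / k`
form a convex set when `1 ≤ ‖z‖`. -/
theorem norm_mul_sub_add_lt {z s t : ℂ} {k : ℝ} (hz : 1 ≤ ‖z‖) (hk : 0 < k)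
    (hs : ‖z * s - k‖ < ‖s‖) (ht : ‖z * t - 1‖ < ‖t‖) :
    ‖z * (t + s) - (k + 1 : ℝ)‖ < ‖t + s‖ := by
  have key (u : ℂ) (l : ℝ) : ‖z * u - l‖ < ‖u‖ ↔
      (‖z‖ ^ 2 - 1) * ‖u‖ ^ 2 - 2 * l * (z * u).re + l ^ 2 < 0 := by
    rw [← sq_lt_sq₀ (norm_nonneg _) (norm_nonneg _)]
    simp only [Complex.sq_norm, Complex.normSq_apply, Complex.sub_re, Complex.sub_im,
      Complex.mul_re, Complex.mul_im, Complex.ofReal_re, Complex.ofReal_im]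
    constructor <;> intro h <;> nlinarith
  have ht' : ‖z * t - (1 : ℝ)‖ < ‖t‖ := by simpa using ht
  rw [key] at hs ht' ⊢
  have hz2 : 0 ≤ ‖z‖ ^ 2 - 1 := by nlinarith
  have hq : k * ‖t + s‖ ^ 2 ≤ (k + 1) * (‖s‖ ^ 2 + k * ‖t‖ ^ 2) := by
    simp only [Complex.sq_norm, Complex.normSq_apply, Complex.add_re, Complex.add_im]
    nlinarith [sq_nonneg (s.re - k * t.re), sq_nonneg (s.im - k * t.im)]
  have hre : (z * (t + s)).re = (z * t).re + (z * s).re := by rw [mul_add, Complex.add_re]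
  rw [hre]
  have h1 := mul_le_mul_of_nonneg_left hq hz2
  have h2 := mul_neg_of_pos_of_neg hk ht'
  have h3 : 0 < k + 1 := by linarith
  have h4 := mul_neg_of_pos_of_neg h3 (add_neg hs h2)
  by_contra! h5
  have h6 := mul_nonneg hk.le h5
  nlinarith

theorem norm_mul_sum_inv_sub_card_lt {z : ℂ} (hz : 1 ≤ ‖z‖) (S : Multiset ℂ)
    (hS : ∀ ζ ∈ S, ‖ζ‖ < 1) (hne : S ≠ 0) :
    ‖z * (S.map fun ζ ↦ 1 / (z - ζ)).sum - (S.card : ℝ)‖ <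
      ‖(S.map fun ζ ↦ 1 / (z - ζ)).sum‖ := by
  induction S using Multiset.induction_on with
  | empty => simp at hne
  | cons ζ S ih =>
    have hζ : ‖ζ‖ < 1 := hS ζ (Multiset.mem_cons_self _ _)
    have hsub : z - ζ ≠ 0 := by
      intro h
      rw [sub_eq_zero] at h
      rw [h] at hz
      linarith
    have ht : ‖z * (1 / (z - ζ)) - 1‖ < ‖1 / (z - ζ)‖ := by
      have : z * (1 / (z - ζ)) - 1 = ζ * (1 / (z - ζ)) := by field_simp; ring
      rw [this, norm_mul]
      have : 0 < ‖1 / (z - ζ)‖ := by simpa using hsub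
      nlinarith
    rcases eq_or_ne S 0 with rfl | hS0
    · simpa using ht
    · have := norm_mul_sub_add_lt hz (Nat.cast_pos.2 (Multiset.card_pos.2 hS0))
        (ih (fun ζ h ↦ hS ζ (Multiset.mem_cons_of_mem h)) hS0) ht
      simpa using this

/-- Laguerre's theorem for the unit disc, in terms of the modified Smirnov operator. -/
theorem smirnov_ne_zero {n : ℕ} (hn : n ≠ 0) {a z : ℂ} (ha : ‖a‖ ≤ 1) (hz : 1 ≤ ‖z‖) {F : ℂ[X]}
    (hF : F.natDegree = n) (hroot : ∀ ζ ∈ F.roots, ‖ζ‖ < 1) : smirnov n a F z ≠ 0 := by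
  intro h0
  have hF0 : F ≠ 0 := by rintro rfl; simp at hF; omega
  have hsp : F.Splits := IsAlgClosed.splits F
  have hcard : F.roots.card = n := by rw [← hF, hsp.natDegree_eq_card_roots]
  have hFz : F.eval z ≠ 0 := by
    intro h
    have := hroot z ((mem_roots hF0).2 h)
    linarith
  have hlt := norm_mul_sum_inv_sub_card_lt hz F.roots hroot (by
    rw [← Multiset.card_pos, hcard]; omega)
  have hd := hsp.eval_derivative_div_eval_of_ne_zero hFz
  rw [← hd, hcard] at hlt
  set m := F.derivative.eval z / F.eval z with hm
  have hderiv : F.derivative.eval z = m * F.eval z := by rw [hm]; field_simp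
  rw [smirnov, hderiv] at h0
  have h1 : m = -a * (z * m - (n : ℝ)) := by
    have : ((1 + a * z) * m - n * a) * F.eval z = 0 := by rw [← h0]; ring
    have := (mul_eq_zero.1 this).resolve_right hFz
    push_cast
    linear_combination this
  have h2 : ‖m‖ ≤ ‖z * m - (n : ℝ)‖ := by
    conv_lhs => rw [h1]
    rw [norm_mul, norm_neg]
    nlinarith [norm_nonneg (z * m - (n : ℝ))]
  linarith

theorem natDegree_smirnovPoly {n : ℕ} (hn : n ≠ 0) {a : ℂ} (ha : ‖a‖ ≤ 1) {F : ℂ[X]}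
    (hF : F.natDegree = n) (hroot : ∀ ζ ∈ F.roots, ‖ζ‖ < 1) :
    (smirnovPoly n a F).natDegree = n - 1 := by
  obtain ⟨k, rfl⟩ := Nat.exists_eq_succ_of_ne_zero hn
  have hF0 : F ≠ 0 := by rintro rfl; simp at hF
  have hsp : F.Splits := IsAlgClosed.splits F
  have hcard : F.roots.card = k + 1 := by rw [← hsp.natDegree_eq_card_roots, hF]
  have hcoeff (j : ℕ) : (smirnovPoly (k + 1) a F).coeff j =
      F.coeff (j + 1) * (j + 1) + (j - (k + 1)) * a * F.coeff j := by
    rw [smirnovPoly, coeff_sub, coeff_add, coeff_C_mul, coeff_C_mul, coeff_derivative]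
    cases j with
    | zero => simp; ring
    | succ j => rw [coeff_X_mul, coeff_derivative]; push_cast; ring
  refine natDegree_eq_of_le_of_coeff_ne_zero ?_ ?_
  · rw [natDegree_le_iff_coeff_eq_zero]
    intro j hj
    rw [hcoeff, coeff_eq_zero_of_natDegree_lt (by omega : F.natDegree < j + 1)]
    rcases (show k + 1 ≤ j by simpa using hj).eq_or_lt with rfl | hlt
    · simp
    · rw [coeff_eq_zero_of_natDegree_lt (by omega : F.natDegree < j)]; simp
  · have hsum : ‖F.roots.sum‖ < k + 1 := by
      have hgen (S : Multiset ℂ) (hS : ∀ ζ ∈ S, ‖ζ‖ < 1) (hne : S ≠ 0) : ‖S.sum‖ < S.card := by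
        induction S using Multiset.induction_on with
        | empty => simp at hne
        | cons ζ S ih =>
          have h1 := hS ζ (Multiset.mem_cons_self _ _)
          have h2 := norm_add_le ζ S.sum
          rcases eq_or_ne S 0 with rfl | hS0
          · simpa using h1
          · have := ih (fun ζ h ↦ hS ζ (Multiset.mem_cons_of_mem h)) hS0
            simp only [Multiset.sum_cons, Multiset.card_cons]
            push_cast
            linarith
      have := hgen F.roots hroot (by rw [← Multiset.card_pos, hcard]; omega)
      rw [hcard] at this
      exact_mod_cast this
    have hnext := hsp.nextCoeff_eq_neg_sum_roots_mul_leadingCoeff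
    rw [nextCoeff_of_natDegree_pos (by omega), hF] at hnext
    have hlead : F.coeff (k + 1) = F.leadingCoeff := by rw [leadingCoeff, hF]
    simp only [Nat.succ_eq_add_one, Nat.add_sub_cancel] at hnext ⊢
    rw [hcoeff, hlead, hnext]
    intro h
    have h1 : F.leadingCoeff * ((k + 1 : ℂ) + a * F.roots.sum) = 0 := by
      rw [← h]; ring
    have h2 := (mul_eq_zero.1 h1).resolve_left (leadingCoeff_ne_zero.2 hF0)
    have h3 : ((k : ℝ) + 1) = ‖a * F.roots.sum‖ := by
      rw [← norm_neg (a * _), ← eq_neg_of_add_eq_zero_left h2]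
      norm_cast
    rw [norm_mul] at h3
    nlinarith [norm_nonneg F.roots.sum]

theorem pow_natDegree_mul_norm_eval_le {G : ℂ[X]} (hroot : ∀ ζ ∈ G.roots, ‖ζ‖ ≤ 1) {R : ℝ}
    (hR : 1 ≤ R) {z : ℂ} (hz : 1 ≤ ‖z‖) :
    ((R + 1) / 2) ^ G.natDegree * ‖G.eval z‖ ≤ ‖G.eval (R * z)‖ := by
  have hsp : G.Splits := IsAlgClosed.splits G
  have hfac (ζ : ℂ) (hζ : ‖ζ‖ ≤ 1) : (R + 1) / 2 * ‖z - ζ‖ ≤ ‖R * z - ζ‖ := by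
    have h0 : 0 ≤ (R + 1) / 2 := by linarith
    rw [← sq_le_sq₀ (by positivity) (norm_nonneg _), mul_pow]
    have h1 : ‖ζ‖ ^ 2 ≤ ‖z‖ ^ 2 := by gcongr; linarith
    have h2 : ‖R * z - ζ‖ ^ 2 - ((R + 1) / 2) ^ 2 * ‖z - ζ‖ ^ 2 =
        (R - 1) / 4 * ((3 * R + 1) * ‖z‖ ^ 2 + 2 * (R - 1) * (z * (starRingEnd ℂ) ζ).re
          - (R + 3) * ‖ζ‖ ^ 2) := by
      simp only [Complex.sq_norm, Complex.normSq_apply, Complex.sub_re, Complex.sub_im,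
        Complex.mul_re, Complex.mul_im, Complex.ofReal_re, Complex.ofReal_im, Complex.conj_re,
        Complex.conj_im]
      ring
    have h3 : -(‖z‖ ^ 2 + ‖ζ‖ ^ 2) ≤ 2 * (z * (starRingEnd ℂ) ζ).re := by
      simp only [Complex.sq_norm, Complex.normSq_apply, Complex.mul_re, Complex.conj_re,
        Complex.conj_im]
      nlinarith [sq_nonneg (z.re + ζ.re), sq_nonneg (z.im + ζ.im)]
    have h4 : 0 ≤ (3 * R + 1) * ‖z‖ ^ 2 + 2 * (R - 1) * (z * (starRingEnd ℂ) ζ).re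
          - (R + 3) * ‖ζ‖ ^ 2 := by
      nlinarith [mul_le_mul_of_nonneg_left h3 (by linarith : 0 ≤ R - 1)]
    have := mul_nonneg (by linarith : 0 ≤ (R - 1) / 4) h4
    linarith
  have hgen (S : Multiset ℂ) (hS : ∀ ζ ∈ S, ‖ζ‖ ≤ 1) : ((R + 1) / 2) ^ S.card *
      ‖(S.map fun ζ ↦ z - ζ).prod‖ ≤ ‖(S.map fun ζ ↦ R * z - ζ).prod‖ := by
    induction S using Multiset.induction_on with
    | empty => simp
    | cons ζ S ih =>
      simp only [Multiset.card_cons, Multiset.map_cons, Multiset.prod_cons, norm_mul]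
      calc _ = ((R + 1) / 2 * ‖z - ζ‖) *
            (((R + 1) / 2) ^ S.card * ‖(S.map fun ζ ↦ z - ζ).prod‖) := by ring
        _ ≤ _ := mul_le_mul (hfac ζ (hS ζ (Multiset.mem_cons_self _ _)))
            (ih fun ζ h ↦ hS ζ (Multiset.mem_cons_of_mem h)) (by positivity) (norm_nonneg _)
  rw [hsp.eval_eq_prod_roots, hsp.eval_eq_prod_roots, norm_mul, norm_mul,
    hsp.natDegree_eq_card_roots, mul_left_comm]
  gcongr
  exact hgen _ hroot

theorem smirnov_add_mul_ne_zero {n : ℕ} (hn : n ≠ 0) {a w z : ℂ} {R : ℝ} (ha : ‖a‖ ≤ 1)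
    (hz : 1 ≤ ‖z‖) (hR : 1 ≤ R) (hw : ‖w‖ < ((R + 1) / 2) ^ (n - 1)) {F : ℂ[X]}
    (hF : F.natDegree = n) (hroot : ∀ ζ : ℂ, 1 ≤ ‖ζ‖ → F.eval ζ ≠ 0) :
    smirnov n a F (R * z) + w * smirnov n a F z ≠ 0 := by
  have hF0 : F ≠ 0 := by rintro rfl; simp at hF; omega
  have hroot' : ∀ ζ ∈ F.roots, ‖ζ‖ < 1 := fun ζ hζ ↦ by
    by_contra! h
    exact hroot ζ h ((mem_roots hF0).1 hζ)
  have hG : ∀ ζ ∈ (smirnovPoly n a F).roots, ‖ζ‖ ≤ 1 := fun ζ hζ ↦ by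
    by_contra! h
    refine smirnov_ne_zero hn ha h.le hF hroot' ?_
    rw [← eval_smirnovPoly]
    exact isRoot_of_mem_roots hζ
  have hle := pow_natDegree_mul_norm_eval_le hG hR hz
  rw [natDegree_smirnovPoly hn ha hF hroot', eval_smirnovPoly, eval_smirnovPoly] at hle
  have hpos := norm_pos_iff.2 (smirnov_ne_zero hn ha hz hF hroot')
  intro h
  rw [eq_neg_of_add_eq_zero_left h, norm_neg, norm_mul] at hle
  nlinarith

/-- The conjugate-reciprocal polynomial `z ^ n * conj (P (1 / conj z))`. -/
noncomputable def conjReflect (n : ℕ) (P : ℂ[X]) : ℂ[X] :=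
  reflect n (P.map (starRingEnd ℂ))

theorem conjReflect_eq_sum {n : ℕ} {P : ℂ[X]} (hP : P.natDegree ≤ n) :
    conjReflect n P =
      ∑ k ∈ Finset.range (n + 1), C ((starRingEnd ℂ) (P.coeff (n - k))) * X ^ k := by
  ext j
  simp only [conjReflect, coeff_reflect, coeff_map, finsetSum_coeff, coeff_C_mul_X_pow]
  rw [Finset.sum_ite_eq]
  split_ifs with h
  · rw [revAt_le (by simpa [Nat.lt_succ_iff] using h)]
  · have hj : n < j := by simpa using h
    rw [revAt_eq_self_of_lt hj, coeff_eq_zero_of_natDegree_lt (by omega), map_zero]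

theorem natDegree_conjReflect_le {n : ℕ} {P : ℂ[X]} (hP : P.natDegree ≤ n) :
    (conjReflect n P).natDegree ≤ n := by
  rw [conjReflect_eq_sum hP]
  refine natDegree_sum_le_of_forall_le _ _ fun k hk ↦ (natDegree_C_mul_X_pow_le _ _).trans ?_
  simpa [Nat.lt_succ_iff] using hk

theorem eval_conjReflect {n : ℕ} {P : ℂ[X]} (hP : P.natDegree ≤ n) {z : ℂ} (hz : z ≠ 0) :
    (conjReflect n P).eval z =
      z ^ n * (starRingEnd ℂ) (P.eval ((starRingEnd ℂ) z)⁻¹) := by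
  let _ : Invertible z⁻¹ := invertibleOfNonzero (inv_ne_zero hz)
  have h := eval₂_reflect_mul_pow (RingHom.id ℂ) z⁻¹ n (P.map (starRingEnd ℂ))
    ((natDegree_map_le).trans hP)
  rw [invOf_eq_inv, inv_inv, ← eval, ← eval, eval_map] at h
  have h2 : (starRingEnd ℂ) (P.eval ((starRingEnd ℂ) z)⁻¹) = P.eval₂ (starRingEnd ℂ) z⁻¹ := by
    rw [eval, hom_eval₂]
    simp
  rw [h2, ← h, conjReflect, mul_left_comm, ← mul_pow, mul_inv_cancel₀ hz, one_pow, mul_one]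

theorem norm_eval_conjReflect {n : ℕ} {P : ℂ[X]} (hP : P.natDegree ≤ n) {z : ℂ} (hz : z ≠ 0) :
    ‖(conjReflect n P).eval z‖ = ‖z‖ ^ n * ‖P.eval ((starRingEnd ℂ) z)⁻¹‖ := by
  rw [eval_conjReflect hP hz, norm_mul, norm_pow, RCLike.norm_conj]

theorem inv_conj_of_norm_eq_one {z : ℂ} (hz : ‖z‖ = 1) : ((starRingEnd ℂ) z)⁻¹ = z := by
  refine inv_eq_of_mul_eq_one_right ?_
  rw [Complex.conj_mul', hz]
  simp

theorem conjReflect_conjReflect (n : ℕ) (P : ℂ[X]) : conjReflect n (conjReflect n P) = P := by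
  ext j
  simp [conjReflect, coeff_reflect]

theorem norm_eval_conjReflect_le {n : ℕ} {P : ℂ[X]} (hP : P.natDegree ≤ n)
    (h0 : ∀ ζ : ℂ, ‖ζ‖ ≤ 1 → P.eval ζ ≠ 0) {ζ : ℂ} (hζ : ‖ζ‖ ≤ 1) :
    ‖(conjReflect n P).eval ζ‖ ≤ ‖P.eval ζ‖ := by
  have hcl : closure (Metric.ball (0 : ℂ) 1) = Metric.closedBall 0 1 :=
    closure_ball _ one_ne_zero
  have hd : DiffContOnCl ℂ (fun x ↦ (conjReflect n P).eval x / P.eval x) (Metric.ball 0 1) := by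
    refine DifferentiableOn.diffContOnCl fun x hx ↦ ?_
    rw [hcl, mem_closedBall_zero_iff] at hx
    exact ((conjReflect n P).differentiableAt.div P.differentiableAt
      (h0 x hx)).differentiableWithinAt
  have hle := Complex.norm_le_of_forall_mem_frontier_norm_le Metric.isBounded_ball hd (C := 1)
    (fun x hx ↦ by
      rw [frontier_ball _ one_ne_zero, mem_sphere_zero_iff_norm] at hx
      have hx0 : x ≠ 0 := by rintro rfl; simp at hx
      rw [norm_div, norm_eval_conjReflect hP hx0, inv_conj_of_norm_eq_one hx, hx, one_pow, one_mul]
      exact div_self_le_one _)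
    (z := ζ) (by rwa [hcl, mem_closedBall_zero_iff])
  rwa [norm_div, div_le_one (norm_pos_iff.2 (h0 ζ hζ))] at hle

theorem norm_eval_le_norm_eval_conjReflect {n : ℕ} {P : ℂ[X]} (hP : P.natDegree ≤ n)
    (h0 : ∀ ζ : ℂ, ‖ζ‖ ≤ 1 → P.eval ζ ≠ 0) {z : ℂ} (hz : 1 ≤ ‖z‖) :
    ‖P.eval z‖ ≤ ‖(conjReflect n P).eval z‖ ∧ (conjReflect n P).eval z ≠ 0 := by
  have hz0 : z ≠ 0 := by rintro rfl; norm_num at hz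
  have hinv : ‖((starRingEnd ℂ) z)⁻¹‖ ≤ 1 := by
    rw [norm_inv, RCLike.norm_conj]
    exact inv_le_one_of_one_le₀ hz
  constructor
  · conv_lhs => rw [← conjReflect_conjReflect n P]
    rw [norm_eval_conjReflect (natDegree_conjReflect_le hP) hz0, norm_eval_conjReflect hP hz0]
    gcongr
    exact norm_eval_conjReflect_le hP h0 hinv
  · rw [← norm_pos_iff, norm_eval_conjReflect hP hz0]
    have := norm_pos_iff.2 (h0 _ hinv)
    have := norm_pos_iff.2 hz0
    positivity

theorem conjReflect_sub_C_mul_eval_ne_zero {n : ℕ} {P : ℂ[X]} (hP : P.natDegree ≤ n)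
    (h0 : ∀ ζ : ℂ, ‖ζ‖ ≤ 1 → P.eval ζ ≠ 0) {γ z : ℂ} (hγ : ‖γ‖ < 1) (hz : 1 ≤ ‖z‖) :
    (conjReflect n P - C γ * P).eval z ≠ 0 := by
  obtain ⟨hle, hne⟩ := norm_eval_le_norm_eval_conjReflect hP h0 hz
  rw [eval_sub, eval_mul, eval_C]
  intro h
  have h1 := congrArg norm (sub_eq_zero.1 h)
  rw [norm_mul] at h1
  have h2 := norm_pos_iff.2 hne
  nlinarith [mul_le_mul_of_nonneg_left hle (norm_nonneg γ)]

theorem natDegree_conjReflect_sub_C_mul {n : ℕ} {P : ℂ[X]} (hP : P.natDegree ≤ n)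
    (h0 : ∀ ζ : ℂ, ‖ζ‖ ≤ 1 → P.eval ζ ≠ 0) {γ : ℂ} (hγ : ‖γ‖ < 1) :
    (conjReflect n P - C γ * P).natDegree = n := by
  refine natDegree_eq_of_le_of_coeff_ne_zero ?_ ?_
  · exact (natDegree_sub_le _ _).trans (max_le (natDegree_conjReflect_le hP)
      ((natDegree_C_mul_le _ _).trans hP))
  · have hle := norm_eval_conjReflect_le hP h0 (ζ := 0) (by simp)
    have hne := norm_pos_iff.2 (h0 0 (by simp))
    rw [← coeff_zero_eq_eval_zero, ← coeff_zero_eq_eval_zero] at hle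
    rw [← coeff_zero_eq_eval_zero] at hne
    have hc0 : (conjReflect n P).coeff 0 = (starRingEnd ℂ) (P.coeff n) := by
      simp [conjReflect, coeff_reflect]
    have hcn : (conjReflect n P).coeff n = (starRingEnd ℂ) (P.coeff 0) := by
      simp [conjReflect, coeff_reflect]
    rw [hc0, RCLike.norm_conj] at hle
    rw [coeff_sub, coeff_C_mul, hcn]
    intro h
    have h1 := congrArg norm (sub_eq_zero.1 h)
    rw [norm_mul, RCLike.norm_conj] at h1
    nlinarith [mul_le_mul_of_nonneg_left hle (norm_nonneg γ)]

theorem norm_eval_le_maxCircle (P : ℂ[X]) {z : ℂ} (hz : ‖z‖ ≤ 1) :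
    ‖P.eval z‖ ≤ maxCircle P := by
  have hcl : closure (Metric.ball (0 : ℂ) 1) = Metric.closedBall 0 1 :=
    closure_ball _ one_ne_zero
  refine Complex.norm_le_of_forall_mem_frontier_norm_le (U := Metric.ball 0 1)
    Metric.isBounded_ball P.differentiable.diffContOnCl (fun x hx ↦ ?_)
    (by rwa [hcl, mem_closedBall_zero_iff])
  rw [frontier_ball _ one_ne_zero, mem_sphere_zero_iff_norm] at hx
  refine le_csSup ?_ ⟨x, hx, rfl⟩
  obtain ⟨B, hB⟩ := (isCompact_sphere (0 : ℂ) 1).exists_bound_of_continuousOn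
    P.continuous.continuousOn
  refine ⟨B, ?_⟩
  rintro y ⟨w, hw, rfl⟩
  exact hB w (mem_sphere_zero_iff_norm.2 hw)

theorem norm_add_norm_le_of_forall_ne_zero {p q x y : ℂ} (hx : x ≠ 0)
    (h : ∀ l g : ℂ, 1 < ‖l‖ → ‖g‖ < 1 →
      (q - (starRingEnd ℂ) l * x) - g * (p - l * y) ≠ 0) :
    ‖p‖ + ‖q‖ ≤ ‖x‖ + ‖y‖ := by
  have hx' := norm_pos_iff.2 hx
  have hqx : ‖q‖ ≤ ‖x‖ := by
    by_contra! hlt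
    refine h ((starRingEnd ℂ) (q / x)) 0 ?_ (by simp) ?_
    · rwa [RCLike.norm_conj, norm_div, one_lt_div hx']
    · rw [Complex.conj_conj]
      field_simp
      ring
  have hdom (l : ℂ) (hl : 1 < ‖l‖) : ‖p - l * y‖ ≤ ‖q - (starRingEnd ℂ) l * x‖ := by
    by_contra! hlt
    have hp : p - l * y ≠ 0 := norm_pos_iff.1 ((norm_nonneg _).trans_lt hlt)
    refine h l ((q - (starRingEnd ℂ) l * x) / (p - l * y)) hl ?_ ?_
    · rwa [norm_div, div_lt_one (norm_pos_iff.2 hp)]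
    · field_simp
      ring
  obtain ⟨u, hu, hux⟩ : ∃ u : ℂ, ‖u‖ = 1 ∧ (‖q‖ : ℂ) * u * x = ‖x‖ * q := by
    rcases eq_or_ne q 0 with rfl | hq
    · exact ⟨1, by simp, by simp⟩
    · have hq' := norm_pos_iff.2 hq
      refine ⟨‖x‖ * q / (‖q‖ * x), ?_, ?_⟩
      · simp
        field_simp
      · have : (‖q‖ : ℂ) ≠ 0 := by exact_mod_cast hq'.ne'
        field_simp
  have hstep (s : ℝ) (hs : 1 < s) : ‖p‖ + ‖q‖ ≤ s * (‖x‖ + ‖y‖) := by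
    have hl : ‖(starRingEnd ℂ) (s * u)‖ = s := by
      rw [RCLike.norm_conj, norm_mul, hu, Complex.norm_real, Real.norm_of_nonneg (by linarith),
        mul_one]
    have h1 := hdom ((starRingEnd ℂ) (s * u)) (by rwa [hl])
    have h2 := norm_sub_norm_le p ((starRingEnd ℂ) (s * u) * y)
    rw [norm_mul, hl] at h2
    have h3 : ‖q - (starRingEnd ℂ) ((starRingEnd ℂ) (s * u)) * x‖ = s * ‖x‖ - ‖q‖ := by
      rw [Complex.conj_conj]
      rcases eq_or_ne q 0 with rfl | hq
      · simp [hu, abs_of_pos (by linarith : 0 < s)]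
      · have hq' := norm_pos_iff.2 hq
        have hqc : (‖q‖ : ℂ) ≠ 0 := by exact_mod_cast hq'.ne'
        have : q - s * u * x = ((‖q‖ - s * ‖x‖ : ℝ) : ℂ) * (q / ‖q‖) := by
          push_cast
          field_simp
          linear_combination -(s : ℂ) * hux
        rw [this, norm_mul, norm_div, Complex.norm_real, Complex.norm_real, norm_norm,
          div_self hq'.ne', mul_one, Real.norm_of_nonpos (by nlinarith)]
        ring
    rw [h3] at h1
    linarith
  refine le_of_forall_pos_le_add fun ε hε ↦ ?_
  have hpos : 0 < ‖x‖ + ‖y‖ := by positivity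
  have := hstep (1 + ε / (‖x‖ + ‖y‖)) (by have := div_pos hε hpos; linarith)
  rwa [add_mul, one_mul, div_mul_cancel₀ _ hpos.ne'] at this

theorem smirnov_bound_of_norm_lt {n : ℕ} (hn : n ≠ 0) {a w z : ℂ} {R : ℝ} (ha : ‖a‖ ≤ 1)
    (hz : 1 ≤ ‖z‖) (hR : 1 ≤ R) (hw : ‖w‖ < ((R + 1) / 2) ^ (n - 1)) {P : ℂ[X]}
    (hP : P.natDegree ≤ n) :
    ‖smirnov n a P (R * z) + w * smirnov n a P z‖
      + ‖smirnov n a (conjReflect n P) (R * z) + w * smirnov n a (conjReflect n P) z‖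
      ≤ (‖(R : ℂ) ^ (n - 1) + w‖ * (n * ‖z‖ ^ (n - 1)) + ‖1 + w‖ * (n * ‖a‖)) * maxCircle P := by
  have hM0 : 0 ≤ maxCircle P := (norm_nonneg _).trans (norm_eval_le_maxCircle P (z := 0) (by simp))
  rcases hM0.eq_or_lt with hM | hM
  · have hP0 : P = 0 := by
      refine eq_zero_of_infinite_isRoot P ((infinite_of_mem_nhds (0 : ℂ)
        (Metric.closedBall_mem_nhds 0 one_pos)).mono fun x hx ↦ ?_)
      have := norm_eval_le_maxCircle P (mem_closedBall_zero_iff.1 hx)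
      rw [← hM] at this
      exact norm_le_zero_iff.1 this
    subst hP0
    simp [smirnov, conjReflect, ← hM]
  set M := maxCircle P
  have hz0 : z ≠ 0 := by rintro rfl; norm_num at hz
  have hX : smirnov n a (X ^ n) (R * z) + w * smirnov n a (X ^ n) z =
      ((R : ℂ) ^ (n - 1) + w) * (n * z ^ (n - 1)) := by
    rw [smirnov_X_pow hn, smirnov_X_pow hn]
    ring
  have hRw : (R : ℂ) ^ (n - 1) + w ≠ 0 := by
    intro h
    have h1 : ‖w‖ = R ^ (n - 1) := by
      rw [eq_neg_of_add_eq_zero_right h, norm_neg, norm_pow, Complex.norm_real,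
        Real.norm_of_nonneg (by linarith)]
    have h2 : ((R + 1) / 2) ^ (n - 1) ≤ R ^ (n - 1) := by gcongr; linarith
    linarith
  have key := norm_add_norm_le_of_forall_ne_zero
    (p := smirnov n a P (R * z) + w * smirnov n a P z)
    (q := smirnov n a (conjReflect n P) (R * z) + w * smirnov n a (conjReflect n P) z)
    (x := M * (((R : ℂ) ^ (n - 1) + w) * (n * z ^ (n - 1))))
    (y := M * ((1 + w) * -(n * a))) (by
      have hMc : (M : ℂ) ≠ 0 := by exact_mod_cast hM.ne'
      have hnc : (n : ℂ) ≠ 0 := by exact_mod_cast hn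
      positivity) (fun l g hl hg ↦ by
      have hdeg : (P - C (l * M)).natDegree ≤ n := by rwa [natDegree_sub_C]
      have hne : ∀ ζ : ℂ, ‖ζ‖ ≤ 1 → (P - C (l * M)).eval ζ ≠ 0 := by
        intro ζ hζ h
        rw [eval_sub, eval_C, sub_eq_zero] at h
        have h1 := norm_eval_le_maxCircle P hζ
        rw [h, norm_mul, Complex.norm_real, Real.norm_of_nonneg hM.le] at h1
        nlinarith
      have h := smirnov_add_mul_ne_zero hn ha hz hR hw
        (natDegree_conjReflect_sub_C_mul hdeg hne hg)
        (fun ζ ↦ conjReflect_sub_C_mul_eval_ne_zero hdeg hne hg)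
      have hrefl : conjReflect n (P - C (l * M)) =
          conjReflect n P - C ((starRingEnd ℂ) l * M) * X ^ n := by
        rw [conjReflect, conjReflect, Polynomial.map_sub, Polynomial.map_C, reflect_sub, reflect_C,
          map_mul (starRingEnd ℂ), Complex.conj_ofReal]
      have hC : P - C (l * M) = P - C (l * M) * 1 := by rw [mul_one]
      rw [hrefl, hC] at h
      simp only [smirnov_sub, smirnov_C_mul, smirnov_one] at h
      intro h'
      apply h
      linear_combination h' - ((starRingEnd ℂ) l) * M * hX)
  refine key.trans (le_of_eq ?_)
  simp only [norm_mul, norm_neg, norm_pow, Complex.norm_real, Complex.norm_natCast,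
    Real.norm_of_nonneg hM0]
  ring

theorem smirnov_bound {n : ℕ} (hn : n ≠ 0) {a w z : ℂ} {R : ℝ} (ha : ‖a‖ ≤ 1)
    (hz : 1 ≤ ‖z‖) (hR : 1 ≤ R) (hw : ‖w‖ ≤ ((R + 1) / 2) ^ (n - 1)) {P : ℂ[X]}
    (hP : P.natDegree ≤ n) :
    ‖smirnov n a P (R * z) + w * smirnov n a P z‖
      + ‖smirnov n a (conjReflect n P) (R * z) + w * smirnov n a (conjReflect n P) z‖
      ≤ (‖(R : ℂ) ^ (n - 1) + w‖ * (n * ‖z‖ ^ (n - 1)) + ‖1 + w‖ * (n * ‖a‖)) * maxCircle P := by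
  have hr : ((R + 1) / 2) ^ (n - 1) ≠ 0 := by positivity
  refine le_on_closure (s := Metric.ball (0 : ℂ) (((R + 1) / 2) ^ (n - 1)))
    (f := fun w ↦ ‖smirnov n a P (R * z) + w * smirnov n a P z‖
      + ‖smirnov n a (conjReflect n P) (R * z) + w * smirnov n a (conjReflect n P) z‖)
    (g := fun w ↦ (‖(R : ℂ) ^ (n - 1) + w‖ * (n * ‖z‖ ^ (n - 1)) + ‖1 + w‖ * (n * ‖a‖))
      * maxCircle P)
    (fun v hv ↦ smirnov_bound_of_norm_lt hn ha hz hR (mem_ball_zero_iff.1 hv) hP)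
    (by fun_prop) (by fun_prop) ?_
  rwa [closure_ball _ hr, mem_closedBall_zero_iff]

/-- The triangle inequality through `(w + 1) * s - 1`, where `s = (r - 1) / (ρ * r - 1)`. -/
theorem exists_intermediate_point {r X R : ℝ} (hr : 1 ≤ r) (hX : 1 ≤ X) (hR : 1 < R)
    (hXr : 2 * X ≤ r * (X + 1)) (hRX : (R + 1) * r ≤ R * X + 1) {w : ℂ}
    (hw : ‖w‖ ≤ (R + 1) / 2 * r) :
    ∃ u : ℂ, ‖u‖ ≤ r ∧ ‖X + u‖ + ‖w - u‖ ≤ ‖R * X + w‖ ∧ ‖1 + u‖ + ‖w - u‖ = ‖1 + w‖ := by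
  have hD : 0 < (R + 1) / 2 * r - 1 := by nlinarith
  set s := (r - 1) / ((R + 1) / 2 * r - 1) with hs
  have hsD : s * ((R + 1) / 2 * r - 1) = r - 1 := div_mul_cancel₀ _ hD.ne'
  have hs0 : 0 ≤ s := div_nonneg (by linarith) hD.le
  have hs1 : s ≤ 1 := by rw [hs, div_le_one hD]; nlinarith
  have hdiff : w - (s * (1 + w) - 1) = ((1 - s : ℝ) : ℂ) * (1 + w) := by push_cast; ring
  have hnd : ‖w - (s * (1 + w) - 1)‖ = (1 - s) * ‖1 + w‖ := by
    rw [hdiff, norm_mul, Complex.norm_real, Real.norm_of_nonneg (by linarith)]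
  have hre : -((R + 1) / 2 * r) ≤ w.re :=
    (neg_le_neg hw).trans ((abs_le.1 (Complex.abs_re_le_norm w)).1)
  have hvB : ‖1 + w‖ ≤ ‖R * X + w‖ := by
    rw [← sq_le_sq₀ (norm_nonneg _) (norm_nonneg _)]
    simp only [Complex.sq_norm, Complex.normSq_apply, Complex.add_re, Complex.add_im,
      Complex.mul_re, Complex.mul_im, Complex.ofReal_re, Complex.ofReal_im, Complex.one_re,
      Complex.one_im]
    have : 0 ≤ (R * X - 1) * (R * X + 1 + 2 * w.re) := mul_nonneg (by nlinarith) (by linarith)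
    nlinarith
  refine ⟨s * (1 + w) - 1, ?_, ?_, ?_⟩
  · have h1 : (s : ℂ) * (1 + w) - 1 = (s : ℂ) * w - ((1 - s : ℝ) : ℂ) := by push_cast; ring
    rw [h1]
    refine (norm_sub_le _ _).trans ?_
    rw [norm_mul, Complex.norm_real, Complex.norm_real, Real.norm_of_nonneg hs0,
      Real.norm_of_nonneg (by linarith : 0 ≤ 1 - s)]
    nlinarith [mul_le_mul_of_nonneg_left hw hs0]
  · rw [hnd]
    have hXs : X - 1 ≤ s * (R * X - 1) := by
      rw [hs, div_mul_eq_mul_div, le_div_iff₀ hD]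
      nlinarith
    set c := (X - 1) / (R * X - 1) with hc
    have hB : 0 < R * X - 1 := by nlinarith
    have hcB : c * (R * X - 1) = X - 1 := div_mul_cancel₀ _ hB.ne'
    have hc0 : 0 ≤ c := div_nonneg (by linarith) hB.le
    have hcs : c ≤ s := by rwa [hc, div_le_iff₀ hB]
    have hcB' : (c : ℂ) * (R * X - 1) = X - 1 := by exact_mod_cast hcB
    have h1 : (X : ℂ) + (s * (1 + w) - 1) = (c : ℂ) * (R * X + w) + ((s - c : ℝ) : ℂ) * (1 + w) := by
      push_cast
      linear_combination -hcB'
    have h2 : ‖(X : ℂ) + (s * (1 + w) - 1)‖ ≤ c * ‖R * X + w‖ + (s - c) * ‖1 + w‖ := by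
      rw [h1]
      refine (norm_add_le _ _).trans ?_
      rw [norm_mul, norm_mul, Complex.norm_real, Complex.norm_real, Real.norm_of_nonneg hc0,
        Real.norm_of_nonneg (by linarith : 0 ≤ s - c)]
    nlinarith
  · rw [hnd, show (1 : ℂ) + (s * (1 + w) - 1) = s * (1 + w) by ring, norm_mul, Complex.norm_real,
      Real.norm_of_nonneg hs0]
    ring

theorem two_mul_pow_le {R : ℝ} (hR : 1 ≤ R) (k : ℕ) :
    2 * R ^ k ≤ ((R + 1) / 2) ^ k * (R ^ k + 1) := by
  induction k with
  | zero => norm_num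
  | succ k ih =>
    have h1 : 1 ≤ R ^ k := one_le_pow₀ hR
    have h2 : 0 ≤ (R - 1) * (R * R ^ k - 1) := mul_nonneg (by linarith) (by nlinarith)
    have h3 : 0 < ((R + 1) / 2) ^ k := by positivity
    rw [pow_succ, pow_succ]
    have h4 := mul_le_mul_of_nonneg_left ih (by linarith : 0 ≤ R)
    have h5 := mul_nonneg h3.le h2
    nlinarith

theorem two_mul_half_add_pow_le {R : ℝ} (hR : 1 ≤ R) (k : ℕ) :
    2 * ((R + 1) / 2) ^ k ≤ R ^ k + 1 := by
  induction k with
  | zero => norm_num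
  | succ k ih =>
    have h1 : 1 ≤ R ^ k := one_le_pow₀ hR
    rw [pow_succ, pow_succ]
    nlinarith [mul_le_mul_of_nonneg_left ih (by linarith : 0 ≤ (R + 1) / 2),
      mul_nonneg (by linarith : 0 ≤ R - 1) (by linarith : 0 ≤ R ^ k - 1)]

theorem smirnov_bound_of_norm_le_pow {n : ℕ} {a w z : ℂ} {R : ℝ} (ha : ‖a‖ ≤ 1)
    (hz : 1 ≤ ‖z‖) (hR : 1 ≤ R) (hw : ‖w‖ ≤ ((R + 1) / 2) ^ n) {P : ℂ[X]}
    (hP : P.natDegree ≤ n) :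
    ‖smirnov n a P (R * z) + w * smirnov n a P z‖
      + ‖smirnov n a (conjReflect n P) (R * z) + w * smirnov n a (conjReflect n P) z‖
      ≤ (‖(R : ℂ) ^ n + w‖ * (n * ‖z‖ ^ (n - 1)) + ‖1 + w‖ * (n * ‖a‖)) * maxCircle P := by
  rcases Nat.eq_zero_or_pos n with rfl | hn
  · have h (F : ℂ[X]) (hF : F.natDegree ≤ 0) (x : ℂ) : smirnov 0 a F x = 0 := by
      rw [eq_C_of_natDegree_le_zero hF]
      simp [smirnov]
    simp [h _ hP, h _ (natDegree_conjReflect_le hP)]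
  obtain ⟨k, rfl⟩ := Nat.exists_eq_succ_of_ne_zero hn.ne'
  rcases hR.eq_or_lt with rfl | hR1
  · simpa using smirnov_bound hn.ne' ha hz le_rfl (by simpa using hw) hP
  set r := ((R + 1) / 2) ^ k
  obtain ⟨u, hur, hXu, h1u⟩ := exists_intermediate_point (one_le_pow₀ (by linarith) : 1 ≤ r)
    (one_le_pow₀ hR : 1 ≤ R ^ k) hR1 (two_mul_pow_le hR k)
    (by have := two_mul_half_add_pow_le hR (k + 1)
        rw [pow_succ, pow_succ] at this
        linarith)
    (w := w) (by rwa [pow_succ, mul_comm] at hw)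
  have hu := smirnov_bound hn.ne' (w := u) ha hz hR hur hP
  have h0 := smirnov_bound hn.ne' (w := 0) (R := 1) ha hz le_rfl (by simp) hP
  simp only [Nat.succ_eq_add_one, Nat.add_sub_cancel, Complex.ofReal_one, one_mul, zero_mul,
    add_zero, one_pow, norm_one] at hu h0 ⊢
  have hsplit (F : ℂ[X]) : ‖smirnov (k + 1) a F (R * z) + w * smirnov (k + 1) a F z‖ ≤
      ‖smirnov (k + 1) a F (R * z) + u * smirnov (k + 1) a F z‖ +
        ‖w - u‖ * ‖smirnov (k + 1) a F z‖ := by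
    rw [← norm_mul]
    refine (congrArg norm ?_).trans_le (norm_add_le _ _)
    ring
  have hM0 : 0 ≤ maxCircle P := (norm_nonneg _).trans (norm_eval_le_maxCircle P (z := 0) (by simp))
  have hX : ‖(R : ℂ) ^ k + u‖ + ‖w - u‖ ≤ ‖(R : ℂ) ^ (k + 1) + w‖ := by
    rw [pow_succ, mul_comm]
    exact_mod_cast hXu
  set N : ℝ := ((k + 1 : ℕ) : ℝ)
  have hN : 0 ≤ N := Nat.cast_nonneg _
  have h2 := mul_le_mul_of_nonneg_left h0 (norm_nonneg (w - u))
  have h3 := mul_le_mul_of_nonneg_right hX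
    (mul_nonneg (mul_nonneg hN (pow_nonneg (norm_nonneg z) k)) hM0)
  have h4 := congrArg (· * (N * ‖a‖ * maxCircle P)) h1u
  linarith [hsplit P, hsplit (conjReflect (k + 1) P)]

theorem statement3 (n : ℕ) (P Q : Polynomial ℂ) (hP : P.natDegree = n)
    (hQ : Q = ∑ k ∈ Finset.range (n + 1),
        Polynomial.C ((starRingEnd ℂ) (P.coeff (n - k))) * Polynomial.X ^ k)
    (a α β : ℂ) (ha : ‖a‖ ≤ 1) (hα : ‖α‖ ≤ 1) (hβ : ‖β‖ ≤ 1)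
    (R : ℝ) (hR : 1 ≤ R) (z : ℂ) (hz : 1 ≤ ‖z‖) :
    ‖smirnov n a P ((R : ℂ) * z) - α * smirnov n a P z
        + β * (((((R + 1) / 2) ^ n - ‖α‖ : ℝ)) : ℂ) * smirnov n a P z‖
      + ‖smirnov n a Q ((R : ℂ) * z) - α * smirnov n a Q z
        + β * (((((R + 1) / 2) ^ n - ‖α‖ : ℝ)) : ℂ) * smirnov n a Q z‖
      ≤ (‖(R : ℂ) ^ n - α + β * (((((R + 1) / 2) ^ n - ‖α‖ : ℝ)) : ℂ)‖
            * ((n : ℝ) * ‖z‖ ^ (n - 1))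
          + ‖1 - α + β * (((((R + 1) / 2) ^ n - ‖α‖ : ℝ)) : ℂ)‖ * ((n : ℝ) * ‖a‖))
        * maxCircle P := by
  rw [← conjReflect_eq_sum hP.le] at hQ
  subst hQ
  set L : ℝ := ((R + 1) / 2) ^ n - ‖α‖ with hL
  have hL0 : 0 ≤ L := by
    have : 1 ≤ ((R + 1) / 2) ^ n := one_le_pow₀ (by linarith)
    linarith
  set w : ℂ := -α + β * (L : ℂ) with hw
  have hwn : ‖w‖ ≤ ((R + 1) / 2) ^ n := by
    have h1 := norm_add_le (-α) (β * (L : ℂ))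
    rw [norm_neg, norm_mul, Complex.norm_real, Real.norm_of_nonneg hL0] at h1
    nlinarith
  have hcomb (F : ℂ[X]) : smirnov n a F (R * z) - α * smirnov n a F z
      + β * (L : ℂ) * smirnov n a F z = smirnov n a F (R * z) + w * smirnov n a F z := by
    rw [hw]
    ring
  rw [hcomb, hcomb, show (R : ℂ) ^ n - α + β * (L : ℂ) = (R : ℂ) ^ n + w by rw [hw]; ring,
    show 1 - α + β * (L : ℂ) = 1 + w by rw [hw]; ring]
  exact smirnov_bound_of_norm_le_pow ha hz hR hwn hP.le
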